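/- Let G be a finite simple graph of order n, let k ≥ 2, and suppose distinct vertices v_1, …, v_k and a partition V_1, …, V_k, V_{k+1} of V \ {v_1,…,v_k} satisfy: for every i, if v_i has a neighbor among {v_1,…,v_k} then V_i ≠ ∅; for all i ≠ j, v_i is adjacent to every vertex of V_i and to no vertex of V_j; and every vertex of V_{k+1} is adjacent to at least two vertices of {v_1,…,v_k}. Suppose there exist a subset I ⊆ {1,…,k} with |I| = s and a set S of vertices of H₂^I dominating H₂^I with |S| ≤ s − 1 and |N_{H₁}(S) ∪ N_{H₁^I}(Ī)| ≥ s. Then S ∪ {v_i : i ∉ I} is a dominating set of G of cardinality at most k − 1; in particular γ(G) ≤ k − 1. -/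

import Mathlib

/-- `D` is a dominating set of `G`: every vertex outside `D` has a neighbor in `D`. -/
def SimpleGraph.IsDomSet {V : Type*} (G : SimpleGraph V) (D : Set V) : Prop :=
  ∀ v ∉ D, ∃ u ∈ D, G.Adj u v

/-- The domination number of `G`. -/
noncomputable def SimpleGraph.domNum {V : Type*} [Fintype V] (G : SimpleGraph V) : ℕ :=
  sInf {m | ∃ D : Set V, G.IsDomSet D ∧ D.ncard = m}

/-- `S` is a set of vertices of the subgraph of `G` induced on `A` which dominates that
subgraph: `S ⊆ A` and every vertex of `A` outside `S` is `G`-adjacent to a vertex of `S`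
(adjacency in the induced subgraph agrees with adjacency in `G`). -/
def SimpleGraph.DominatesOn {V : Type*} (G : SimpleGraph V) (A S : Set V) : Prop :=
  S ⊆ A ∧ ∀ w ∈ A, w ∉ S → ∃ u ∈ S, G.Adj u w

/-- The vertex set of the induced subgraph `H₂^I`: the union of the `Vᵢ` for `i ∈ I`
together with the vertices of `V_{k+1}` having no neighbor `v_j` with `j ∉ I`. -/
def H2I {V : Type*} {k : ℕ} (G : SimpleGraph V) (v : Fin k → V)
    (Vi : Fin k → Set V) (Vlast : Set V) (I : Set (Fin k)) : Set V :=
  (⋃ i ∈ I, Vi i) ∪ {w ∈ Vlast | ∀ j ∉ I, ¬ G.Adj w (v j)}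

/-- `N_{H₁}(S)`: the set of vertices `vᵢ` (`1 ≤ i ≤ k`) adjacent in `G` to a vertex of `S`. -/
def NH1 {V : Type*} {k : ℕ} (G : SimpleGraph V) (v : Fin k → V) (S : Set V) : Set V :=
  {x | ∃ i : Fin k, x = v i ∧ ∃ u ∈ S, G.Adj (v i) u}

/-- `N_{H₁^I}(Ī)`: the set of vertices `vᵢ` with `i ∈ I` adjacent in `G` to some `v_j`
with `j ∉ I`. -/
def NH1I {V : Type*} {k : ℕ} (G : SimpleGraph V) (v : Fin k → V) (I : Set (Fin k)) : Set V :=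
  {x | ∃ i ∈ I, x = v i ∧ ∃ j ∉ I, G.Adj (v i) (v j)}

/-- Every `vᵢ` adjacent to a vertex of `H₂^I` has `i ∈ I`. -/
theorem mem_of_adj_of_mem_H2I {V : Type*} {k : ℕ} {G : SimpleGraph V} {v : Fin k → V}
    {Vi : Fin k → Set V} {Vlast : Set V} {I : Set (Fin k)}
    (hnot_adj : ∀ i j : Fin k, i ≠ j → ∀ w ∈ Vi j, ¬ G.Adj (v i) w)
    {i : Fin k} {u : V} (hu : u ∈ H2I G v Vi Vlast I) (hadj : G.Adj (v i) u) : i ∈ I := by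
  by_contra hi
  rcases hu with hu | hu
  · obtain ⟨j, hj, huj⟩ := Set.mem_iUnion₂.mp hu
    exact hnot_adj i j (fun h => hi (h ▸ hj)) u huj hadj
  · exact hu.2 i hi hadj.symm

theorem SimpleGraph.IsDomSet.domNum_le {V : Type*} [Fintype V] {G : SimpleGraph V} {D : Set V}
    (hD : G.IsDomSet D) : G.domNum ≤ D.ncard :=
  Nat.sInf_le ⟨D, hD, rfl⟩

/-- If `S ⊆ H₂^I` and `N_{H₁}(S) ∪ N_{H₁^I}(Ī)` has at least `|I|` elements, then it is
exactly `{vᵢ : i ∈ I}`. -/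
theorem NH1_union_NH1I_eq_image {V : Type*} {k : ℕ} {G : SimpleGraph V} {v : Fin k → V}
    {Vi : Fin k → Set V} {Vlast : Set V} {I : Set (Fin k)} {S : Set V}
    (hinj : Function.Injective v)
    (hnot_adj : ∀ i j : Fin k, i ≠ j → ∀ w ∈ Vi j, ¬ G.Adj (v i) w)
    (hS : S ⊆ H2I G v Vi Vlast I) (hN : I.ncard ≤ (NH1 G v S ∪ NH1I G v I).ncard) :
    NH1 G v S ∪ NH1I G v I = v '' I := by
  refine Set.eq_of_subset_of_ncard_le ?_ ?_ ((Set.toFinite I).image v)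
  · rintro _ (⟨i, rfl, u, hu, hadj⟩ | ⟨i, hi, rfl, -⟩)
    · exact Set.mem_image_of_mem v (mem_of_adj_of_mem_H2I hnot_adj (hS hu) hadj)
    · exact Set.mem_image_of_mem v hi
  · rwa [Set.ncard_image_of_injective I hinj]

/-- Suppose distinct vertices `v 0, …, v (k-1)` (`k ≥ 2`) and a partition
`V 0, …, V (k-1), Vlast` of the remaining vertices satisfy conditions (b), (c), (d) of the
family `𝓕`, and suppose there exist `I ⊆ {1,…,k}` with `|I| = s` and a dominating set `S`
of `H₂^I` with `|S| ≤ s - 1` and `|N_{H₁}(S) ∪ N_{H₁^I}(Ī)| ≥ s`.  Then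
`S ∪ {vᵢ : i ∉ I}` is a dominating set of `G` of cardinality at most `k - 1`;
in particular `γ(G) ≤ k - 1`. -/
theorem domNum_le_of_not_condC {V : Type*} [Fintype V] (G : SimpleGraph V) (k : ℕ)
    (hk : 2 ≤ k) (v : Fin k → V) (Vi : Fin k → Set V) (Vlast : Set V)
    (hinj : Function.Injective v)
    (hdisj : ∀ i j : Fin k, i ≠ j → Disjoint (Vi i) (Vi j))
    (hdisj_last : ∀ i : Fin k, Disjoint (Vi i) Vlast)
    (hcover : ((⋃ i : Fin k, Vi i) ∪ Vlast) = Set.univ \ Set.range v)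
    (hnonempty : ∀ i : Fin k, (∃ j : Fin k, G.Adj (v i) (v j)) → (Vi i).Nonempty)
    (hadj_own : ∀ i : Fin k, ∀ w ∈ Vi i, G.Adj (v i) w)
    (hnot_adj : ∀ i j : Fin k, i ≠ j → ∀ w ∈ Vi j, ¬ G.Adj (v i) w)
    (hlast : ∀ w ∈ Vlast, ∃ i j : Fin k, i ≠ j ∧ G.Adj w (v i) ∧ G.Adj w (v j))
    (I : Set (Fin k)) (S : Set V)
    (hS : G.DominatesOn (H2I G v Vi Vlast I) S)
    (hScard : S.ncard < I.ncard)
    (hN : I.ncard ≤ (NH1 G v S ∪ NH1I G v I).ncard) :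
    G.IsDomSet (S ∪ v '' Iᶜ) ∧ (S ∪ v '' Iᶜ).ncard ≤ k - 1 ∧ G.domNum ≤ k - 1 := by
  have hdom : G.IsDomSet (S ∪ v '' Iᶜ) := by
    intro w hw
    have hwS : w ∉ S := fun h => hw (Or.inl h)
    by_cases hr : w ∈ Set.range v
    · obtain ⟨i, rfl⟩ := hr
      have hi : i ∈ I := by
        by_contra hi
        exact hw (Or.inr (Set.mem_image_of_mem v hi))
      have hmem : v i ∈ NH1 G v S ∪ NH1I G v I :=
        NH1_union_NH1I_eq_image hinj hnot_adj hS.1 hN ▸ Set.mem_image_of_mem v hi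
      rcases hmem with ⟨j, hj, u, hu, hadj⟩ | ⟨j, -, hj, l, hl, hadj⟩
      · exact ⟨u, Or.inl hu, hj ▸ hadj.symm⟩
      · exact ⟨v l, Or.inr (Set.mem_image_of_mem v hl), hj ▸ hadj.symm⟩
    · by_cases hA : w ∈ H2I G v Vi Vlast I
      · obtain ⟨u, hu, hadj⟩ := hS.2 w hA hwS
        exact ⟨u, Or.inl hu, hadj⟩
      · suffices ∃ j ∉ I, G.Adj (v j) w by
          obtain ⟨j, hj, hadj⟩ := this
          exact ⟨v j, Or.inr (Set.mem_image_of_mem v hj), hadj⟩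
        have hw' : w ∈ (⋃ i : Fin k, Vi i) ∪ Vlast := hcover ▸ ⟨Set.mem_univ w, hr⟩
        rcases hw' with h | h
        · obtain ⟨i, hi⟩ := Set.mem_iUnion.mp h
          exact ⟨i, fun hiI => hA (Or.inl (Set.mem_biUnion hiI hi)), hadj_own i w hi⟩
        · by_contra! hno
          exact hA (Or.inr ⟨h, fun j hj hadj => hno j hj hadj.symm⟩)
  have hcard : (S ∪ v '' Iᶜ).ncard ≤ k - 1 := by
    have hunion := Set.ncard_union_le S (v '' Iᶜ)
    rw [Set.ncard_image_of_injective _ hinj] at hunion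
    have hcompl := Set.ncard_add_ncard_compl I
    rw [Nat.card_fin] at hcompl
    omega
  exact ⟨hdom, hcard, hdom.domNum_le.trans hcard⟩
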